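/- (Segre type [1111(11)]) Let n = 3 with coordinates (u¹,u²,u³), let a₂, a₃, α be real constants, define the symmetric metric g by g₁₁ = a₃(u²)² + a₂(u³)², g₁₂ = −a₃u¹u² + αu³, g₁₃ = −a₂u¹u³ + αu², g₂₂ = a₂ + a₃(u¹)², g₂₃ = −2αu¹, g₃₃ = a₃ + a₂(u¹)², and let U = {u ∈ ℝ³ : det g(u) ≠ 0 and (a₂² − α²)(a₃² − α²)/det g(u) > 0}. Define c_{ijk} := (1/3)(∂_j g_{ik} − ∂_k g_{ij}) and the skew-symmetric field w by w₁₂ = u³·√((a₂² − α²)(a₃² − α²)/det g), w₂₃ = 0, w₃₁ = u²·√((a₂² − α²)(a₃² − α²)/det g) (with w_{ji} = −w_{ij}, w_{ii} = 0). Then (g, c, w) satisfies conditions (cond1) on U. -/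

import Mathlib

open scoped BigOperators

/-- Partial derivative `∂_k f` in the `k`-th coordinate direction. -/
noncomputable def pd {n : ℕ} (k : Fin n) (f : (Fin n → ℝ) → ℝ) (u : Fin n → ℝ) : ℝ :=
  fderiv ℝ f u (Pi.single k 1)

/-- Conditions (cond1) for a triple `(g, c, w)` on a set `U ⊆ ℝⁿ`:
`g` is the (lower-index) metric `g_{ij}`, `c` are the lowered coefficients `c_{ijk}`,
`w` is the skew-symmetric 2-form `w_{ij}`, and `c^s_{jk} := g^{si} c_{ijk}` is computed
via the pointwise inverse matrix `(g u)⁻¹`. -/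
def Cond1 {n : ℕ} (U : Set (Fin n → ℝ))
    (g : (Fin n → ℝ) → Matrix (Fin n) (Fin n) ℝ)
    (c : (Fin n → ℝ) → Fin n → Fin n → Fin n → ℝ)
    (w : (Fin n → ℝ) → Matrix (Fin n) (Fin n) ℝ) : Prop :=
  ∀ u ∈ U,
    (∀ i j k, pd k (fun x => g x i j) u + c u i j k + c u j i k = 0) ∧
    (∀ i j k, c u i j k + c u i k j = 0) ∧
    (∀ i j k, pd k (fun x => g x i j) u + pd i (fun x => g x j k) u
        + pd j (fun x => g x k i) u = 0) ∧
    (∀ i j, w u i j + w u j i = 0) ∧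
    (∀ i j l, pd l (fun x => w x i j) u
        = ∑ s, (∑ a, (g u)⁻¹ s a * c u a i j) * w u s l) ∧
    (∀ m l p k, pd k (fun x => c x p m l) u
        + ∑ s, (∑ a, (g u)⁻¹ s a * c u a m l) * c u s p k + w u m l * w u p k = 0)

theorem pd_of_hasFDerivAt {n : ℕ} {k : Fin n} {f : (Fin n → ℝ) → ℝ} {u : Fin n → ℝ}
    {f' : (Fin n → ℝ) →L[ℝ] ℝ} (h : HasFDerivAt f f' u) : pd k f u = f' (Pi.single k 1) := by
  rw [pd, h.fderiv]

theorem pd_const' {n : ℕ} (k : Fin n) (a : ℝ) (u : Fin n → ℝ) : pd k (fun _ => a) u = 0 := by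
  simp [pd]

theorem pd_coord {n : ℕ} (k i : Fin n) (u : Fin n → ℝ) :
    pd k (fun x => x i) u = if i = k then 1 else 0 := by
  rw [pd_of_hasFDerivAt (hasFDerivAt_apply i u)]
  simp [Pi.single_apply]

theorem pd_add' {n : ℕ} (k : Fin n) (f h : (Fin n → ℝ) → ℝ) (u : Fin n → ℝ)
    (hf : DifferentiableAt ℝ f u) (hh : DifferentiableAt ℝ h u) :
    pd k (fun x => f x + h x) u = pd k f u + pd k h u := by
  simp [pd, fderiv_fun_add hf hh]

theorem pd_sub' {n : ℕ} (k : Fin n) (f h : (Fin n → ℝ) → ℝ) (u : Fin n → ℝ)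
    (hf : DifferentiableAt ℝ f u) (hh : DifferentiableAt ℝ h u) :
    pd k (fun x => f x - h x) u = pd k f u - pd k h u := by
  simp [pd, fderiv_fun_sub hf hh]

theorem pd_neg' {n : ℕ} (k : Fin n) (f : (Fin n → ℝ) → ℝ) (u : Fin n → ℝ) :
    pd k (fun x => - f x) u = - pd k f u := by
  simp [pd, fderiv_fun_neg]

theorem pd_mul' {n : ℕ} (k : Fin n) (f h : (Fin n → ℝ) → ℝ) (u : Fin n → ℝ)
    (hf : DifferentiableAt ℝ f u) (hh : DifferentiableAt ℝ h u) :
    pd k (fun x => f x * h x) u = f u * pd k h u + h u * pd k f u := by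
  simp [pd, fderiv_fun_mul hf hh]

theorem pd_sq {n : ℕ} (k : Fin n) (f : (Fin n → ℝ) → ℝ) (u : Fin n → ℝ)
    (hf : DifferentiableAt ℝ f u) :
    pd k (fun x => f x ^ 2) u = 2 * f u * pd k f u := by
  simp only [sq]; rw [pd_mul' k f f u hf hf]; ring

theorem sqrt_aux {n : ℕ} (K : ℝ) (D : (Fin n → ℝ) → ℝ) (u : Fin n → ℝ)
    (hD : DifferentiableAt ℝ D u) (h0 : D u ≠ 0) (hpos : 0 < K / D u) :
    DifferentiableAt ℝ (fun x => Real.sqrt (K / D x)) u ∧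
    ∀ k, pd k (fun x => Real.sqrt (K / D x)) u
      = - (Real.sqrt (K / D u) * pd k D u) / (2 * D u) := by
  have h1 : HasDerivAt (fun t : ℝ => Real.sqrt (K / t))
      (-(Real.sqrt (K / D u)) / (2 * D u)) (D u) := by
    have h2 : HasDerivAt (fun t : ℝ => K / t) (-K / (D u)^2) (D u) := by
      have := (hasDerivAt_inv h0).const_mul K
      have h2' : HasDerivAt (fun t : ℝ => K / t) (K * -(D u ^ 2)⁻¹) (D u) := this
      exact h2'.congr_deriv (by ring)
    have h3 := h2.sqrt hpos.ne'
    convert h3 using 1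
    have hs : 0 < Real.sqrt (K / D u) := Real.sqrt_pos.mpr hpos
    have hsq : Real.sqrt (K / D u) * Real.sqrt (K / D u) = K / D u :=
      Real.mul_self_sqrt hpos.le
    have hK : K = Real.sqrt (K / D u) * Real.sqrt (K / D u) * D u := by
      rw [hsq]; field_simp
    generalize Real.sqrt (K / D u) = S at *
    have hS : S ≠ 0 := hs.ne'
    rw [hK]
    field_simp
  have h4 := h1.comp_hasFDerivAt u hD.hasFDerivAt
  refine ⟨h4.differentiableAt, fun k => ?_⟩
  have h5 := pd_of_hasFDerivAt (k := k) h4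
  simp only [Function.comp_def] at h5
  rw [h5]
  simp [pd]
  ring

/-- The table of partial derivatives of the metric. -/
noncomputable def dGtab (a₂ a₃ α : ℝ) (k : Fin 3) (u : Fin 3 → ℝ) : Matrix (Fin 3) (Fin 3) ℝ :=
  ![!![0, -(a₃ * u 1), -(a₂ * u 2); -(a₃ * u 1), 2 * a₃ * u 0, -(2 * α);
       -(a₂ * u 2), -(2 * α), 2 * a₂ * u 0],
    !![2 * a₃ * u 1, -(a₃ * u 0), α; -(a₃ * u 0), 0, 0; α, 0, 0],
    !![2 * a₂ * u 2, α, -(a₂ * u 0); α, 0, 0; -(a₂ * u 0), 0, 0]] k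

/-- The table of `w` without the square root factor. -/
noncomputable def Wtab (u : Fin 3 → ℝ) : Matrix (Fin 3) (Fin 3) ℝ :=
  !![0, u 2, -(u 1); -(u 2), 0, 0; u 1, 0, 0]

/-- The table of partial derivatives of `Wtab`. -/
noncomputable def dWtab (k : Fin 3) : Matrix (Fin 3) (Fin 3) ℝ :=
  ![0, !![0, 0, -1; 0, 0, 0; 1, 0, 0], !![0, 1, 0; -1, 0, 0; 0, 0, 0]] k

/-- The determinant of the metric. -/
noncomputable def Dpoly (a₂ a₃ α : ℝ) (u : Fin 3 → ℝ) : ℝ :=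
  (a₃ * (u 1) ^ 2 + a₂ * (u 2) ^ 2) * (a₂ + a₃ * (u 0) ^ 2) * (a₃ + a₂ * (u 0) ^ 2)
  - (a₃ * (u 1) ^ 2 + a₂ * (u 2) ^ 2) * (2 * α * u 0) ^ 2
  - (-(a₃ * u 0 * u 1) + α * u 2) ^ 2 * (a₃ + a₂ * (u 0) ^ 2)
  - (-(a₂ * u 0 * u 2) + α * u 1) ^ 2 * (a₂ + a₃ * (u 0) ^ 2)
  - 2 * (-(a₃ * u 0 * u 1) + α * u 2) * (-(a₂ * u 0 * u 2) + α * u 1) * (2 * α * u 0)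

set_option maxHeartbeats 8000000 in
/-- Segre type [1111(11)]. With `(u¹,u²,u³) = (u 0, u 1, u 2)`,
constants `a₂ a₃ α : ℝ`, metric as indicated,
`U = {u : det g(u) ≠ 0 ∧ (a₂²−α²)(a₃²−α²)/det g(u) > 0}`,
`c_{ijk} = (1/3)(∂_j g_{ik} − ∂_k g_{ij})` and the skew form with
`w₁₂ = u³√((a₂²−α²)(a₃²−α²)/det g)`, `w₂₃ = 0`, `w₃₁ = u²√((a₂²−α²)(a₃²−α²)/det g)`,
conditions (cond1) hold on `U`. -/
theorem segre_111111_satisfies_cond1 (a₂ a₃ α : ℝ)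
    (g : (Fin 3 → ℝ) → Matrix (Fin 3) (Fin 3) ℝ)
    (hg : g = fun u =>
      !![a₃ * (u 1) ^ 2 + a₂ * (u 2) ^ 2, -(a₃ * u 0 * u 1) + α * u 2,
           -(a₂ * u 0 * u 2) + α * u 1;
         -(a₃ * u 0 * u 1) + α * u 2, a₂ + a₃ * (u 0) ^ 2, -(2 * α * u 0);
         -(a₂ * u 0 * u 2) + α * u 1, -(2 * α * u 0), a₃ + a₂ * (u 0) ^ 2])
    (U : Set (Fin 3 → ℝ))
    (hU : U = {u | (g u).det ≠ 0 ∧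
        0 < (a₂ ^ 2 - α ^ 2) * (a₃ ^ 2 - α ^ 2) / (g u).det})
    (c : (Fin 3 → ℝ) → Fin 3 → Fin 3 → Fin 3 → ℝ)
    (hc : c = fun u i j k =>
      (1 / 3) * (pd j (fun x => g x i k) u - pd k (fun x => g x i j) u))
    (w : (Fin 3 → ℝ) → Matrix (Fin 3) (Fin 3) ℝ)
    (hw : w = fun u =>
      !![0, u 2 * Real.sqrt ((a₂ ^ 2 - α ^ 2) * (a₃ ^ 2 - α ^ 2) / (g u).det),
           -(u 1 * Real.sqrt ((a₂ ^ 2 - α ^ 2) * (a₃ ^ 2 - α ^ 2) / (g u).det));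
         -(u 2 * Real.sqrt ((a₂ ^ 2 - α ^ 2) * (a₃ ^ 2 - α ^ 2) / (g u).det)), 0, 0;
         u 1 * Real.sqrt ((a₂ ^ 2 - α ^ 2) * (a₃ ^ 2 - α ^ 2) / (g u).det), 0, 0]) :
    Cond1 U g c w := by
  have hdet : ∀ u, (g u).det = Dpoly a₂ a₃ α u := by
    intro u
    rw [hg, Matrix.det_fin_three, Dpoly]
    simp
    ring
  have hpg : ∀ i j k u, pd k (fun x => g x i j) u = dGtab a₂ a₃ α k u i j := by
    intro i j k u
    subst hg
    fin_cases i <;> fin_cases j <;>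
      simp (disch := fun_prop) [pd_add', pd_neg', pd_mul', pd_sq, pd_coord, pd_const'] <;>
      fin_cases k <;> simp [dGtab] <;> ring
  have hc' : c = fun u i j k =>
      (1 / 3) * (dGtab a₂ a₃ α j u i k - dGtab a₂ a₃ α k u i j) := by
    rw [hc]; simp only [hpg]
  clear hc
  have hw' : ∀ x i j, w x i j = Wtab x i j *
      Real.sqrt ((a₂ ^ 2 - α ^ 2) * (a₃ ^ 2 - α ^ 2) / Dpoly a₂ a₃ α x) := by
    intro x i j
    rw [hw]
    simp only [hdet]
    fin_cases i <;> fin_cases j <;> simp [Wtab]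
  simp only [hdet] at hU hw
  have hDd : ∀ u, DifferentiableAt ℝ (Dpoly a₂ a₃ α) u := by
    intro u; unfold Dpoly; fun_prop
  intro u hu
  rw [hU] at hu
  obtain ⟨h0, hpos⟩ := hu
  obtain ⟨hSd, hSp⟩ := sqrt_aux _ _ u (hDd u) h0 hpos
  have hSS : Real.sqrt ((a₂ ^ 2 - α ^ 2) * (a₃ ^ 2 - α ^ 2) / Dpoly a₂ a₃ α u) ^ 2
     = (a₂ ^ 2 - α ^ 2) * (a₃ ^ 2 - α ^ 2) / Dpoly a₂ a₃ α u := Real.sq_sqrt hpos.le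
  have hinv : ∀ s a, (g u)⁻¹ s a = (Dpoly a₂ a₃ α u)⁻¹ * (g u).adjugate s a := by
    intro s a
    rw [Matrix.inv_def, hdet]; simp
  refine ⟨?_, ?_, ?_, ?_, ?_, ?_⟩
  · intro i j k
    rw [hpg, hc']
    fin_cases i <;> fin_cases j <;> fin_cases k <;> simp [dGtab] <;> ring
  · intro i j k
    rw [hc']; ring
  · intro i j k
    simp only [hpg]
    fin_cases i <;> fin_cases j <;> fin_cases k <;> simp [dGtab] <;> ring
  · intro i j
    rw [hw]
    fin_cases i <;> fin_cases j <;> simp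
  · have hDp : ∀ k, pd k (Dpoly a₂ a₃ α) u = ∑ i, ∑ j, (g u).adjugate i j * dGtab a₂ a₃ α k u i j := by
      intro k
      unfold Dpoly
      rw [hg, Matrix.adjugate_fin_three]
      simp (disch := fun_prop) only [pd_add', pd_sub', pd_neg', pd_mul', pd_sq, pd_coord, pd_const']
      fin_cases k <;> simp [dGtab, Fin.sum_univ_three] <;> ring
    intro i j l
    have hpW : pd l (fun x => Wtab x i j) u = dWtab l i j := by
      fin_cases i <;> fin_cases j <;> fin_cases l <;>
        simp [Wtab, dWtab, pd_neg', pd_coord, pd_const']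
    have hWd : DifferentiableAt ℝ (fun x => Wtab x i j) u := by
      fin_cases i <;> fin_cases j <;> simp [Wtab] <;> fun_prop
    have key : Dpoly a₂ a₃ α u * dWtab l i j
        - Wtab u i j * (∑ i, ∑ j, (g u).adjugate i j * dGtab a₂ a₃ α l u i j) / 2
        = ∑ s, (∑ a, (g u).adjugate s a * c u a i j) * Wtab u s l := by
      rw [hg, hc', Matrix.adjugate_fin_three, Dpoly]
      fin_cases i <;> fin_cases j <;> fin_cases l <;>
        simp [Wtab, dWtab, dGtab, Fin.sum_univ_three] <;> ring
    simp only [hw']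
    rw [pd_mul' _ _ _ _ hWd hSd, hSp, hDp, hpW]
    generalize Real.sqrt ((a₂ ^ 2 - α ^ 2) * (a₃ ^ 2 - α ^ 2) / Dpoly a₂ a₃ α u) = S at *
    have e1 : ∑ s, (∑ a, (g u)⁻¹ s a * c u a i j) * (Wtab u s l * S)
        = (Dpoly a₂ a₃ α u)⁻¹ * S * ∑ s, (∑ a, (g u).adjugate s a * c u a i j) * Wtab u s l := by
      simp only [hinv, Fin.sum_univ_three]; ring
    rw [e1, ← key]
    field_simp
    ring
  · intro m l p k
    have hpc : ∃ d, pd k (fun x => c x p m l) u = d ∧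
        Dpoly a₂ a₃ α u * d + ∑ s, (∑ a, (g u).adjugate s a * c u a m l) * c u s p k
        + (a₂ ^ 2 - α ^ 2) * (a₃ ^ 2 - α ^ 2) * (Wtab u m l * Wtab u p k) = 0 := by
      refine ⟨_, rfl, ?_⟩
      rw [hg, hc', Matrix.adjugate_fin_three]
      fin_cases m <;> fin_cases l <;> fin_cases p <;>
        simp (disch := fun_prop) [dGtab, pd_add', pd_sub', pd_neg', pd_mul', pd_coord, pd_const'] <;>
        fin_cases k <;> simp [Dpoly, Wtab, dGtab, Fin.sum_univ_three] <;> ring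
    obtain ⟨d, hd, key⟩ := hpc
    rw [hd]
    simp only [hw']
    have e1 : ∑ s, (∑ a, (g u)⁻¹ s a * c u a m l) * c u s p k
        = (Dpoly a₂ a₃ α u)⁻¹ * ∑ s, (∑ a, (g u).adjugate s a * c u a m l) * c u s p k := by
      simp only [hinv, Fin.sum_univ_three]; ring
    generalize Real.sqrt ((a₂ ^ 2 - α ^ 2) * (a₃ ^ 2 - α ^ 2) / Dpoly a₂ a₃ α u) = S at *
    have e2 : Wtab u m l * S * (Wtab u p k * S) = Wtab u m l * Wtab u p k * S ^ 2 := by ring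
    rw [e1, e2, hSS]
    generalize ∑ s, (∑ a, (g u).adjugate s a * c u a m l) * c u s p k = X at *
    field_simp
    linear_combination key
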